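/- There is an absolute constant C > 0 with the following property. Let G be a finite edge-weighted graph with positive edge weights, let ε ∈ (0, 1) and ℓ > 0. Let 𝒫 be a finite set of shortest paths in G, and let Q_1, Q_2, …, Q_r be shortest paths in G such that for every 1 ≤ i ≤ r, Q_i shares at least one vertex with some member of 𝒫 and w(Q_i) ≤ ℓ. Let s_i and t_i denote the endpoints of Q_i, and let k be the number of distinct points in {s_1, t_1, …, s_r, t_r}. Then there exists a subset F ⊆ E(G) with w(F) ≤ C · k · ε⁻² · ℓ · |𝒫| such that d_F(s_i, t_i) ≤ (1 + ε) · d_G(s_i, t_i) for every 1 ≤ i ≤ r. -/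

import Mathlib

open scoped ENNReal BigOperators

universe u

/-- A finite edge-weighted graph on vertex type `V`: an edge set of unordered pairs of
distinct vertices together with a positive weight on each edge. -/
structure WGraph (V : Type u) where
  edges : Finset (Sym2 V)
  loopless : ∀ e ∈ edges, ¬ e.IsDiag
  w : Sym2 V → ℝ
  w_pos : ∀ e ∈ edges, 0 < w e

/-- The length of the walk starting at `p` and visiting the points of the list in order,
with respect to the edge weight `w`. -/
noncomputable def walkLen {V : Type u} (w : Sym2 V → ℝ) : V → List V → ℝ
  | _, [] => 0
  | p, x :: xs => w s(p, x) + walkLen w x xs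

/-- `p :: l` is a walk from `p` to `q` all of whose steps are edges of `F`. -/
def IsWalkIn {V : Type u} (F : Finset (Sym2 V)) (p q : V) (l : List V) : Prop :=
  List.Chain (fun a b => s(a, b) ∈ F) p l ∧ (p :: l).getLast (List.cons_ne_nil p l) = q

/-- The distance from `p` to `q` using only edges of `F`: the infimum in `[0, ∞]` of
lengths of walks in `F` from `p` to `q`. -/
noncomputable def distIn {V : Type u} (G : WGraph V) (F : Finset (Sym2 V)) (p q : V) :
    ℝ≥0∞ :=
  ⨅ (l : List V) (_ : IsWalkIn F p q l), ENNReal.ofReal (walkLen G.w p l)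

/-- The graph distance `d_G`. -/
noncomputable def gdist {V : Type u} (G : WGraph V) (p q : V) : ℝ≥0∞ :=
  distIn G G.edges p q

/-- `p :: l` is a shortest path in `G` from `p` to `q`: a walk with no repeated vertex
whose length equals the graph distance between its endpoints. -/
def IsShortestPath {V : Type u} (G : WGraph V) (p q : V) (l : List V) : Prop :=
  IsWalkIn G.edges p q l ∧ (p :: l).Nodup ∧
    ENNReal.ofReal (walkLen G.w p l) = gdist G p q

/-- The total weight of a set of edges. -/
noncomputable def setWeight {V : Type u} (G : WGraph V) (F : Finset (Sym2 V)) : ℝ :=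
  ∑ e ∈ F, G.w e

/-- The set of edges of the walk `p :: l`. -/
def edgesOfWalk {V : Type u} [DecidableEq V] : V → List V → Finset (Sym2 V)
  | _, [] => ∅
  | p, x :: xs => insert s(p, x) (edgesOfWalk x xs)


section helpers

variable {V : Type u}

lemma isWalkIn_nil {F : Finset (Sym2 V)} {p q : V} : IsWalkIn F p q [] ↔ p = q := by
  simp [IsWalkIn, List.Chain]

lemma isWalkIn_cons {F : Finset (Sym2 V)} {p q x : V} {l : List V} :
    IsWalkIn F p q (x :: l) ↔ s(p, x) ∈ F ∧ IsWalkIn F x q l := by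
  simp [IsWalkIn, List.Chain, and_assoc]

lemma walkLen_append (w : Sym2 V → ℝ) (l₁ l₂ : List V) (p q : V) (F : Finset (Sym2 V))
    (h : IsWalkIn F p q l₁) :
    walkLen w p (l₁ ++ l₂) = walkLen w p l₁ + walkLen w q l₂ := by
  induction l₁ generalizing p with
  | nil => rw [isWalkIn_nil] at h; subst h; simp [walkLen]
  | cons x l ih =>
    rw [isWalkIn_cons] at h
    simp only [List.cons_append, walkLen]
    rw [ih x h.2]; ring

lemma isWalkIn_append {F : Finset (Sym2 V)} {p q r : V} {l₁ l₂ : List V}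
    (h₁ : IsWalkIn F p q l₁) (h₂ : IsWalkIn F q r l₂) : IsWalkIn F p r (l₁ ++ l₂) := by
  induction l₁ generalizing p with
  | nil => rw [isWalkIn_nil] at h₁; subst h₁; simpa
  | cons x l ih =>
    rw [isWalkIn_cons] at h₁
    rw [List.cons_append, isWalkIn_cons]
    exact ⟨h₁.1, ih h₁.2⟩

lemma isWalkIn_reverse (w : Sym2 V → ℝ) {F : Finset (Sym2 V)} {p q : V} {l : List V}
    (h : IsWalkIn F p q l) : ∃ l', IsWalkIn F q p l' ∧ walkLen w q l' = walkLen w p l := by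
  induction l generalizing p with
  | nil => rw [isWalkIn_nil] at h; subst h; exact ⟨[], isWalkIn_nil.2 rfl, rfl⟩
  | cons x l ih =>
    rw [isWalkIn_cons] at h
    obtain ⟨l', h1, h2⟩ := ih h.2
    have h3 : IsWalkIn F x p [p] := by
      rw [isWalkIn_cons, isWalkIn_nil]
      exact ⟨by rw [Sym2.eq_swap]; exact h.1, rfl⟩
    refine ⟨l' ++ [p], isWalkIn_append h1 h3, ?_⟩
    rw [walkLen_append w l' [p] q x F h1, h2]
    simp only [walkLen]
    rw [Sym2.eq_swap]; ring

lemma isWalkIn_split {F : Finset (Sym2 V)} {p q v : V} {l : List V}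
    (h : IsWalkIn F p q l) (hv : v ∈ p :: l) :
    ∃ l₁ l₂, l = l₁ ++ l₂ ∧ IsWalkIn F p v l₁ ∧ IsWalkIn F v q l₂ := by
  by_cases hpv : v = p
  · subst hpv; exact ⟨[], l, rfl, isWalkIn_nil.2 rfl, h⟩
  · induction l generalizing p with
    | nil => simp [hpv] at hv
    | cons x l ih =>
      rw [isWalkIn_cons] at h
      by_cases hx : v = x
      · subst hx
        exact ⟨[v], l, rfl, by rw [isWalkIn_cons, isWalkIn_nil]; exact ⟨h.1, rfl⟩, h.2⟩
      · obtain ⟨l₁, l₂, e, h1, h2⟩ := ih h.2 (by simpa [hpv] using hv) hx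
        exact ⟨x :: l₁, l₂, by simp [e], by rw [isWalkIn_cons]; exact ⟨h.1, h1⟩, h2⟩

lemma distIn_le (G : WGraph V) {F : Finset (Sym2 V)} {p q : V} {l : List V}
    (h : IsWalkIn F p q l) : distIn G F p q ≤ ENNReal.ofReal (walkLen G.w p l) :=
  iInf₂_le l h

lemma isWalkIn_mono {F F' : Finset (Sym2 V)} (hF : F ⊆ F') {p q : V} {l : List V}
    (h : IsWalkIn F p q l) : IsWalkIn F' p q l := by
  induction l generalizing p with
  | nil => rwa [isWalkIn_nil] at *
  | cons x l ih =>
    rw [isWalkIn_cons] at *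
    exact ⟨hF h.1, ih h.2⟩

lemma distIn_mono (G : WGraph V) {F F' : Finset (Sym2 V)} (hF : F ⊆ F') (p q : V) :
    distIn G F' p q ≤ distIn G F p q :=
  le_iInf₂ fun _ h => distIn_le G (isWalkIn_mono hF h)

lemma distIn_triangle (G : WGraph V) (F : Finset (Sym2 V)) (p q r : V) :
    distIn G F p r ≤ distIn G F p q + distIn G F q r := by
  conv_rhs => unfold distIn
  simp only [ENNReal.iInf_add, ENNReal.add_iInf]
  refine le_iInf₂ fun l₁ h₁ => le_iInf₂ fun l₂ h₂ => ?_
  refine (distIn_le G (isWalkIn_append ‹IsWalkIn F p q _› ‹IsWalkIn F q r _›)).trans ?_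
  rw [walkLen_append G.w _ _ p q F ‹_›]
  exact ENNReal.ofReal_add_le

lemma distIn_symm_le (G : WGraph V) (F : Finset (Sym2 V)) (p q : V) :
    distIn G F q p ≤ distIn G F p q := by
  refine le_iInf₂ fun l h => ?_
  obtain ⟨l', h1, h2⟩ := isWalkIn_reverse G.w h
  exact h2 ▸ distIn_le G h1

lemma distIn_symm (G : WGraph V) (F : Finset (Sym2 V)) (p q : V) :
    distIn G F q p = distIn G F p q :=
  le_antisymm (distIn_symm_le G F p q) (distIn_symm_le G F q p)

lemma walkLen_nonneg (G : WGraph V) {p q : V} {l : List V}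
    (h : IsWalkIn G.edges p q l) : 0 ≤ walkLen G.w p l := by
  induction l generalizing p with
  | nil => simp [walkLen]
  | cons x l ih =>
    rw [isWalkIn_cons] at h
    have := G.w_pos _ h.1
    have := ih h.2
    simp only [walkLen]; linarith

/-- a shortest walk -/
def Short (G : WGraph V) (p q : V) (l : List V) : Prop :=
  IsWalkIn G.edges p q l ∧ ENNReal.ofReal (walkLen G.w p l) = gdist G p q

lemma short_split (G : WGraph V) {p q v : V} {l₁ l₂ : List V}
    (h : Short G p q (l₁ ++ l₂)) (h₁ : IsWalkIn G.edges p v l₁)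
    (h₂ : IsWalkIn G.edges v q l₂) : Short G p v l₁ ∧ Short G v q l₂ := by
  obtain ⟨_, h⟩ := h
  rw [walkLen_append G.w _ _ p v _ h₁,
    ENNReal.ofReal_add (walkLen_nonneg G h₁) (walkLen_nonneg G h₂)] at h
  have ht := distIn_triangle G G.edges p v q
  have a1 := distIn_le G h₁
  have a2 := distIn_le G h₂
  unfold gdist at h
  rw [← h] at ht
  refine ⟨⟨h₁, le_antisymm ?_ a1⟩, ⟨h₂, le_antisymm ?_ a2⟩⟩
  · exact (ENNReal.add_le_add_iff_right ENNReal.ofReal_ne_top).1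
      (ht.trans (add_le_add le_rfl a2))
  · exact (ENNReal.add_le_add_iff_left ENNReal.ofReal_ne_top).1
      (ht.trans (add_le_add a1 le_rfl))

lemma trim_left (G : WGraph V) (B : V → Prop) {p q : V} {l : List V}
    (h : Short G p q l) (hB : ∃ x ∈ p :: l, B x) :
    ∃ u l', Short G u q l' ∧ B u ∧ ∀ x ∈ p :: l, B x → x ∈ u :: l' := by
  induction l generalizing p with
  | nil => exact ⟨p, [], h, by simpa using hB, fun x hx _ => hx⟩
  | cons y l ih =>
    by_cases hp : B p
    · exact ⟨p, y :: l, h, hp, fun x hx _ => hx⟩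
    · have hw := isWalkIn_cons.1 h.1
      have hs := (short_split G (l₁ := [y]) (l₂ := l) h
        (by rw [isWalkIn_cons, isWalkIn_nil]; exact ⟨hw.1, rfl⟩) hw.2).2
      have key : ∀ x ∈ p :: y :: l, B x → x ∈ y :: l := by
        intro x hx hb
        rcases List.mem_cons.1 hx with rfl | hx
        · exact absurd hb hp
        · exact hx
      obtain ⟨x, hx, hb⟩ := hB
      obtain ⟨u, l', h1, h2, h3⟩ := ih hs ⟨x, key x hx hb, hb⟩
      exact ⟨u, l', h1, h2, fun x hx hb => h3 x (key x hx hb) hb⟩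

lemma trim_right_aux (G : WGraph V) (B : V → Prop) {p q : V} {l : List V}
    (h : IsWalkIn G.edges p q l) (hB : ∃ x ∈ p :: l, B x) :
    ∃ v l' l'', l = l' ++ l'' ∧ IsWalkIn G.edges p v l' ∧ IsWalkIn G.edges v q l'' ∧ B v ∧
      ∀ x ∈ p :: l, B x → x ∈ p :: l' := by
  induction l generalizing p with
  | nil =>
    exact ⟨p, [], [], rfl, isWalkIn_nil.2 rfl, h, by simpa using hB, fun x hx _ => hx⟩
  | cons y l ih =>
    have hw := isWalkIn_cons.1 h
    by_cases hy : ∃ x ∈ y :: l, B x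
    · obtain ⟨v, l', l'', e, h1, h2, h3, h4⟩ := ih hw.2 hy
      refine ⟨v, y :: l', l'', by simp [e], isWalkIn_cons.2 ⟨hw.1, h1⟩, h2, h3, ?_⟩
      intro x hx hb
      rcases List.mem_cons.1 hx with rfl | hx
      · simp
      · exact List.mem_cons_of_mem _ (h4 x hx hb)
    · have key : ∀ x ∈ p :: y :: l, B x → x = p := by
        intro x hx hb
        rcases List.mem_cons.1 hx with rfl | hx
        · rfl
        · exact absurd ⟨x, hx, hb⟩ hy
      obtain ⟨x, hx, hb⟩ := hB
      have := key x hx hb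
      subst this
      refine ⟨x, [], y :: l, rfl, isWalkIn_nil.2 rfl, h, hb, ?_⟩
      intro z hz hbz
      simp [key z hz hbz]

lemma trim (G : WGraph V) (B : V → Prop) {p q : V} {l : List V}
    (h : Short G p q l) (hB : ∃ x ∈ p :: l, B x) :
    ∃ u v l', Short G u v l' ∧ B u ∧ B v ∧ ∀ x ∈ p :: l, B x → x ∈ u :: l' := by
  obtain ⟨u, l₁, h1, h2, h3⟩ := trim_left G B h hB
  obtain ⟨v, l', l'', e, k1, k2, k3, k4⟩ := trim_right_aux G B h1.1 ⟨u, by simp, h2⟩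
  subst e
  exact ⟨u, v, l', (short_split G h1 k1 k2).1, h2, k3,
    fun x hx hb => k4 x (h3 x hx hb) hb⟩

variable [DecidableEq V]

lemma setWeight_union_le (G : WGraph V) {A B : Finset (Sym2 V)} (hA : A ⊆ G.edges) :
    setWeight G (A ∪ B) ≤ setWeight G A + setWeight G B := by
  unfold setWeight
  rw [← Finset.sum_union_inter]
  have : 0 ≤ ∑ e ∈ A ∩ B, G.w e :=
    Finset.sum_nonneg fun e he => (G.w_pos e (hA (Finset.mem_inter.1 he).1)).le
  linarith

lemma setWeight_biUnion_le (G : WGraph V) {ι : Type*} [DecidableEq ι] (S : Finset ι)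
    (f : ι → Finset (Sym2 V)) (hf : ∀ i, f i ⊆ G.edges) (M : ℝ)
    (hM : ∀ i, setWeight G (f i) ≤ M) :
    setWeight G (S.biUnion f) ≤ S.card * M := by
  induction S using Finset.induction_on with
  | empty => simp [setWeight]
  | insert a S ha ih =>
    rw [Finset.biUnion_insert, Finset.card_insert_of_notMem ha]
    have h1 := setWeight_union_le G (A := f a) (B := S.biUnion f) (hf a)
    have := hM a
    push_cast
    linarith

lemma walk_edges (G : WGraph V) {p q : V} {l : List V} (h : IsWalkIn G.edges p q l) :
    edgesOfWalk p l ⊆ G.edges ∧ setWeight G (edgesOfWalk p l) ≤ walkLen G.w p l ∧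
      IsWalkIn (edgesOfWalk p l) p q l := by
  induction l generalizing p with
  | nil =>
    rw [isWalkIn_nil] at h
    exact ⟨by simp [edgesOfWalk], by simp [edgesOfWalk, setWeight, walkLen], isWalkIn_nil.2 h⟩
  | cons x l ih =>
    rw [isWalkIn_cons] at h
    obtain ⟨h1, h2, h3⟩ := ih h.2
    refine ⟨Finset.insert_subset h.1 h1, ?_, ?_⟩
    · have := setWeight_union_le G (A := {s(p, x)}) (B := edgesOfWalk x l)
        (by simpa using h.1)
      have e : setWeight G {s(p, x)} = G.w s(p, x) := by simp [setWeight]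
      simp only [edgesOfWalk, walkLen, Finset.insert_eq]
      linarith
    · rw [isWalkIn_cons]
      exact ⟨by simp [edgesOfWalk], isWalkIn_mono (by simp [edgesOfWalk]) h3⟩

lemma core (G : WGraph V) (ε : ℝ) (hε : 0 < ε) (s q : V) (l : List V) :
    ∀ (u : V) (c : ℝ) (F₀ : Finset (Sym2 V)), F₀ ⊆ G.edges → 0 ≤ c →
      distIn G F₀ s u ≤ ENNReal.ofReal c → IsWalkIn G.edges u q l →
      ∃ F, F₀ ⊆ F ∧ F ⊆ G.edges ∧
        setWeight G F ≤ setWeight G F₀ + walkLen G.w u l + (c + walkLen G.w u l) / ε ∧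
        ∀ v ∈ l, (∃ l₀, Short G s v l₀) →
          distIn G F s v ≤ ENNReal.ofReal (1 + ε) * gdist G s v := by
  induction l with
  | nil =>
    intro u c F₀ hF hc hd hw
    refine ⟨F₀, subset_rfl, hF, ?_, by simp⟩
    have : 0 ≤ c / ε := by positivity
    simp only [walkLen]; simp; exact this
  | cons v l ih =>
    intro u c F₀ hF hc hd hw
    rw [isWalkIn_cons] at hw
    have hwp := G.w_pos _ hw.1
    by_cases hcase : (∃ l₀, Short G s v l₀ ∧ (1 + ε) * walkLen G.w s l₀ < c + G.w s(u, v))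
    · obtain ⟨l₀, hs, hlt⟩ := hcase
      obtain ⟨e1, e2, e3⟩ := walk_edges G hs.1
      have hd0 := walkLen_nonneg G hs.1
      have hdv : distIn G (F₀ ∪ edgesOfWalk s l₀) s v ≤ ENNReal.ofReal (walkLen G.w s l₀) :=
        distIn_le G (isWalkIn_mono Finset.subset_union_right e3)
      obtain ⟨F, f1, f2, f3, f4⟩ := ih v (walkLen G.w s l₀) (F₀ ∪ edgesOfWalk s l₀)
        (Finset.union_subset hF e1) hd0 hdv hw.2
      refine ⟨F, Finset.subset_union_left.trans f1, f2, ?_, ?_⟩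
      · have hu := setWeight_union_le G (A := F₀) (B := edgesOfWalk s l₀) hF
        have hkey : walkLen G.w s l₀ + (walkLen G.w s l₀ + walkLen G.w v l) / ε ≤
            (c + (G.w s(u, v) + walkLen G.w v l)) / ε := by
          rw [le_div_iff₀ hε, add_mul, div_mul_cancel₀ _ hε.ne']
          linarith
        simp only [walkLen]
        linarith
      · intro x hx hB
        rcases List.mem_cons.1 hx with rfl | hx
        · refine (distIn_mono G f1 _ _).trans (hdv.trans ?_)
          rw [← hs.2]
          refine le_mul_of_one_le_left zero_le ?_
          rw [ENNReal.one_le_ofReal]; linarith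
        · exact f4 x hx hB
    · obtain ⟨e1, e2, e3⟩ := walk_edges G (p := u) (q := v) (l := [v])
        (by rw [isWalkIn_cons, isWalkIn_nil]; exact ⟨hw.1, rfl⟩)
      have hl : walkLen G.w u [v] = G.w s(u, v) := by simp [walkLen]
      rw [hl] at e2
      have hdv : distIn G (F₀ ∪ edgesOfWalk u [v]) s v ≤ ENNReal.ofReal (c + G.w s(u, v)) := by
        rw [ENNReal.ofReal_add hc hwp.le]
        refine (distIn_triangle G _ s u v).trans (add_le_add ?_ ?_)
        · exact (distIn_mono G Finset.subset_union_left _ _).trans hd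
        · rw [← hl]
          exact distIn_le G (isWalkIn_mono Finset.subset_union_right e3)
      obtain ⟨F, f1, f2, f3, f4⟩ := ih v (c + G.w s(u, v)) (F₀ ∪ edgesOfWalk u [v])
        (Finset.union_subset hF e1) (by linarith) hdv hw.2
      refine ⟨F, Finset.subset_union_left.trans f1, f2, ?_, ?_⟩
      · have hu := setWeight_union_le G (A := F₀) (B := edgesOfWalk u [v]) hF
        simp only [walkLen]
        rw [← add_assoc c]
        linarith
      · intro x hx hB
        rcases List.mem_cons.1 hx with rfl | hx
        · obtain ⟨l₀, hs⟩ := hB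
          have hle : c + G.w s(u, x) ≤ (1 + ε) * walkLen G.w s l₀ := by
            by_contra hcon
            exact hcase ⟨l₀, hs, not_le.1 hcon⟩
          refine (distIn_mono G f1 _ _).trans (hdv.trans ?_)
          rw [← hs.2, ← ENNReal.ofReal_mul (by linarith)]
          exact ENNReal.ofReal_le_ofReal hle
        · exact f4 x hx hB

lemma single (G : WGraph V) (ε ℓ : ℝ) (hε : 0 < ε) (hε1 : ε < 1) (hℓ : 0 < ℓ) (s a b : V)
    (lp : List V) (hP : Short G a b lp) :
    ∃ F ⊆ G.edges, setWeight G F ≤ 6 * ε⁻¹ ^ 2 * ℓ ∧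
      ∀ v ∈ a :: lp, (∃ l₀, Short G s v l₀ ∧ walkLen G.w s l₀ ≤ ℓ) →
        distIn G F s v ≤ ENNReal.ofReal (1 + ε) * gdist G s v := by
  by_cases hB : ∃ x ∈ a :: lp, ∃ l₀, Short G s x l₀ ∧ walkLen G.w s l₀ ≤ ℓ
  · obtain ⟨u, v, l', h1, ⟨l₁, hu, hul⟩, ⟨l₂, hv, hvl⟩, h4⟩ := trim G _ hP hB
    obtain ⟨e1, e2, e3⟩ := walk_edges G hu.1
    have hdu : distIn G (edgesOfWalk s l₁) s u ≤ ENNReal.ofReal (walkLen G.w s l₁) :=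
      distIn_le G e3
    have n1 := walkLen_nonneg G hu.1
    have n2 := walkLen_nonneg G hv.1
    have hW : walkLen G.w u l' ≤ 2 * ℓ := by
      have : ENNReal.ofReal (walkLen G.w u l') ≤
          ENNReal.ofReal (walkLen G.w s l₁ + walkLen G.w s l₂) := by
        rw [h1.2, ENNReal.ofReal_add n1 n2, hu.2, hv.2]
        unfold gdist
        rw [← distIn_symm G _ s u]
        exact distIn_triangle _ _ _ _ _
      rw [ENNReal.ofReal_le_ofReal_iff (by linarith)] at this
      linarith
    obtain ⟨F, f1, f2, f3, f4⟩ := core G ε hε s v l' u _ _ e1 n1 hdu h1.1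
    refine ⟨F, f2, ?_, ?_⟩
    · have hi : 1 ≤ ε⁻¹ := (one_le_inv₀ hε).2 hε1.le
      have : (walkLen G.w s l₁ + walkLen G.w u l') / ε ≤ 3 * ℓ * ε⁻¹ := by
        rw [div_eq_mul_inv]
        exact mul_le_mul_of_nonneg_right (by linarith) (by linarith)
      have h6 : ε⁻¹ ≤ ε⁻¹ ^ 2 := by nlinarith
      have h7 : ℓ * ε⁻¹ ≤ ℓ * ε⁻¹ ^ 2 := mul_le_mul_of_nonneg_left h6 hℓ.le
      have h8 : ℓ * 1 ≤ ℓ * ε⁻¹ := mul_le_mul_of_nonneg_left hi hℓ.le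
      linarith
    · intro x hx hb
      have hm := h4 x hx hb
      rcases List.mem_cons.1 hm with rfl | hm
      · refine (distIn_mono G f1 _ _).trans (hdu.trans ?_)
        rw [hu.2]
        refine le_mul_of_one_le_left zero_le ?_
        rw [ENNReal.one_le_ofReal]; linarith
      · obtain ⟨l₀, hs, _⟩ := hb
        exact f4 x hm ⟨l₀, hs⟩
  · refine ⟨∅, by simp, ?_, fun v hv hb => absurd ⟨v, hv, hb⟩ hB⟩
    simp only [setWeight, Finset.sum_empty]
    positivity

end helpers

/-- Claim 10: a light spanner preserving distances of shortest paths crossing a finite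
set 𝒫 of shortest paths. -/
theorem crossing_path_set_spanner :
    ∃ C : ℝ, 0 < C ∧
      ∀ (V : Type u) [Fintype V] [DecidableEq V] (G : WGraph V) (ε ℓ : ℝ),
        0 < ε → ε < 1 → 0 < ℓ →
        ∀ (m : ℕ) (a b : Fin m → V) (lp : Fin m → List V),
          (∀ j, IsShortestPath G (a j) (b j) (lp j)) →
        ∀ (r : ℕ) (s t : Fin r → V) (lQ : Fin r → List V),
          (∀ i, IsShortestPath G (s i) (t i) (lQ i)) →
          (∀ i, walkLen G.w (s i) (lQ i) ≤ ℓ) →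
          (∀ i, ∃ j, ∃ v, v ∈ s i :: lQ i ∧ v ∈ a j :: lp j) →
          ∃ F ⊆ G.edges,
            setWeight G F ≤
              C * ((Finset.image s Finset.univ ∪ Finset.image t Finset.univ).card : ℝ) *
                ε⁻¹ ^ 2 * ℓ * m ∧
            ∀ i, distIn G F (s i) (t i) ≤ ENNReal.ofReal (1 + ε) * gdist G (s i) (t i) := by
  refine ⟨6, by norm_num, ?_⟩
  intro V _ _ G ε ℓ hε hε1 hℓ m a b lp hP r s t lQ hQ hQl hX
  have hsingle := fun (x : V) (j : Fin m) =>
    single G ε ℓ hε hε1 hℓ x (a j) (b j) (lp j) ⟨(hP j).1, (hP j).2.2⟩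
  choose f hf1 hf2 hf3 using hsingle
  set K := Finset.image s Finset.univ ∪ Finset.image t Finset.univ with hK
  let S : Finset (V × Fin m) := K ×ˢ Finset.univ
  let g : V × Fin m → Finset (Sym2 V) := fun y => f y.1 y.2
  have hsub : ∀ x ∈ K, ∀ j, f x j ⊆ S.biUnion g := fun x hx j =>
    Finset.subset_biUnion_of_mem g (x := (x, j)) (by simp [S, hx])
  refine ⟨S.biUnion g, ?_, ?_, ?_⟩
  · exact Finset.biUnion_subset.2 fun y _ => hf1 y.1 y.2
  · have h := setWeight_biUnion_le G S g (fun y => hf1 y.1 y.2) _ (fun y => hf2 y.1 y.2)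
    have hc : (S.card : ℝ) = K.card * m := by simp [S]
    rw [hc] at h
    refine h.trans (le_of_eq ?_)
    ring
  · intro i
    obtain ⟨j, v, hvQ, hvP⟩ := hX i
    obtain ⟨l₁, l₂, e, h1, h2⟩ := isWalkIn_split (hQ i).1 hvQ
    have hshort : Short G (s i) (t i) (l₁ ++ l₂) := e ▸ ⟨(hQ i).1, (hQ i).2.2⟩
    have hlen := hQl i
    have hd := hshort.2
    rw [e, walkLen_append G.w _ _ _ v _ h1] at hlen
    rw [walkLen_append G.w _ _ _ v _ h1,
      ENNReal.ofReal_add (walkLen_nonneg G h1) (walkLen_nonneg G h2)] at hd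
    have n1 := walkLen_nonneg G h1
    have n2 := walkLen_nonneg G h2
    obtain ⟨s1, s2⟩ := short_split G hshort h1 h2
    obtain ⟨l₃, h3, h3l⟩ := isWalkIn_reverse G.w h2
    have s3 : Short G (t i) v l₃ := by
      refine ⟨h3, ?_⟩
      rw [h3l, s2.2]
      exact distIn_symm G _ _ _
    have d1 := hf3 (s i) j v hvP ⟨l₁, s1, by linarith⟩
    have d2 := hf3 (t i) j v hvP ⟨l₃, s3, by linarith⟩
    have d1' := (distIn_mono G (hsub (s i) (by simp [hK]) j) (s i) v).trans d1
    have d2' := (distIn_mono G (hsub (t i) (by simp [hK]) j) (t i) v).trans d2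
    refine (distIn_triangle G _ (s i) v (t i)).trans ?_
    rw [← hd, mul_add, s1.2, s2.2]
    refine add_le_add d1' ?_
    rw [distIn_symm G _ (t i) v]
    refine d2'.trans (le_of_eq ?_)
    congr 1
    exact distIn_symm G _ _ _
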